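/- Fix k ≥ 1 and let X_k = {0,1}^(ℕ^k) with the k commuting shift operators T₁, …, T_k. Let P ⊆ X_k be a Π⁰₁ class such that λ(P) > 0 and λ(P) is a computable real. Then every Schnorr random Z ∈ X_k is multiply recurrent in P, i.e., there is n ≥ 1 with Z ∈ ⋂_{1≤i≤k} T_i^{-n}(P). -/

import Mathlib

open MeasureTheory

/-- `σ` is a prefix of the infinite binary sequence `Z`. -/
def IsPrefixOf (σ : List Bool) (Z : ℕ → Bool) : Prop :=
  ∀ i : ℕ, i < σ.length → σ.getD i false = Z i

/-- The open subset `⟦S⟧` of Cantor space generated by a set of finite binary strings. -/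
def openCl (S : Set (List Bool)) : Set (ℕ → Bool) :=
  {Z | ∃ σ ∈ S, IsPrefixOf σ Z}

/-- A set of finite binary strings is computably enumerable. -/
def CEStrings (S : Set (List Bool)) : Prop :=
  ∃ f : ℕ → Option (List Bool), Computable f ∧ S = {σ | ∃ n, f n = some σ}

/-- `P` is a Π⁰₁ class: the complement of the open set generated by a c.e. set of strings. -/
def Pi01Class (P : Set (ℕ → Bool)) : Prop :=
  ∃ S : Set (List Bool), CEStrings S ∧ P = (openCl S)ᶜ

/-- The shift operator `T` on Cantor space: `T Z n = Z (n+1)`. -/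
def shift (Z : ℕ → Bool) : ℕ → Bool := fun n => Z (n + 1)

/-- `Z` is `k`-recurrent in `P`: for some `n ≥ 1`, `T^{n i} Z ∈ P` for all `1 ≤ i ≤ k`. -/
def KRecurrentIn (k : ℕ) (P : Set (ℕ → Bool)) (Z : ℕ → Bool) : Prop :=
  ∃ n : ℕ, 1 ≤ n ∧ ∀ i : ℕ, 1 ≤ i → i ≤ k → shift^[n * i] Z ∈ P

/-- `Z` is multiply recurrent in `P`: `k`-recurrent in `P` for every `k ≥ 1`. -/
def MultiplyRecurrentIn (P : Set (ℕ → Bool)) (Z : ℕ → Bool) : Prop :=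
  ∀ k : ℕ, 1 ≤ k → KRecurrentIn k P Z

/-- `μ` is the uniform (fair-coin) product measure on Cantor space:
each basic cylinder determined by a string `σ` has measure `2^{-|σ|}`. -/
def IsUniformMeasure (μ : Measure (ℕ → Bool)) : Prop :=
  ∀ σ : List Bool, μ {Z | IsPrefixOf σ Z} = 2⁻¹ ^ σ.length

/-- A uniformly computably enumerable sequence of sets of strings. -/
def UniformlyCE (S : ℕ → Set (List Bool)) : Prop :=
  ∃ f : ℕ → ℕ → Option (List Bool), Computable₂ f ∧
    ∀ m, S m = {σ | ∃ n, f m n = some σ}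

/-- A Martin-Löf test with respect to the measure `μ`. -/
def MLTest (μ : Measure (ℕ → Bool)) (S : ℕ → Set (List Bool)) : Prop :=
  UniformlyCE S ∧ ∀ m, μ (openCl (S m)) ≤ 2⁻¹ ^ m

/-- `Z` is Martin-Löf random w.r.t. `μ`. -/
def MLRandom (μ : Measure (ℕ → Bool)) (Z : ℕ → Bool) : Prop :=
  ∀ S : ℕ → Set (List Bool), MLTest μ S → ∃ m, Z ∉ openCl (S m)

/-- A real is computable if some computable sequence of rationals approximates it
within `2^{-j}`. -/
def ComputableReal (x : ℝ) : Prop :=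
  ∃ q : ℕ → ℚ, Computable q ∧ ∀ j : ℕ, |x - (q j : ℝ)| ≤ 2⁻¹ ^ j

/-- A Schnorr test w.r.t. `μ`: a Martin-Löf test whose levels have uniformly
computable measures. -/
def SchnorrTest (μ : Measure (ℕ → Bool)) (S : ℕ → Set (List Bool)) : Prop :=
  UniformlyCE S ∧ (∀ m, μ (openCl (S m)) ≤ 2⁻¹ ^ m) ∧
    ∃ q : ℕ → ℕ → ℚ, Computable₂ q ∧
      ∀ m j : ℕ, |(μ (openCl (S m))).toReal - (q m j : ℝ)| ≤ 2⁻¹ ^ j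

/-- `Z` is Schnorr random w.r.t. `μ`. -/
def SchnorrRandom (μ : Measure (ℕ → Bool)) (Z : ℕ → Bool) : Prop :=
  ∀ S : ℕ → Set (List Bool), SchnorrTest μ S → ∃ m, Z ∉ openCl (S m)

/-- `Z` is weakly (Kurtz) random w.r.t. `μ`: it belongs to no Π⁰₁ class of measure `0`. -/
def KurtzRandom (μ : Measure (ℕ → Bool)) (Z : ℕ → Bool) : Prop :=
  ∀ P : Set (ℕ → Bool), Pi01Class P → μ P = 0 → Z ∉ P
/-- The `i`-th shift operator on `X_k = {0,1}^(ℕ^k)`: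
`T_i Z (u₁,…,u_k) = Z (u₁,…,u_i + 1,…,u_k)`. -/
def shiftK {k : ℕ} (i : Fin k) (Z : (Fin k → ℕ) → Bool) : (Fin k → ℕ) → Bool :=
  fun u => Z (fun j => if j = i then u j + 1 else u j)

/-- The array of size `n` coded by `(n, l)` (the list `l` records the `n ^ k` values of a
map `{0,…,n-1}^k → {0,1}` in the order given by `finFunctionFinEquiv`) agrees with `Z`
on its domain. -/
def ArrayAgrees {k : ℕ} (n : ℕ) (l : List Bool) (Z : (Fin k → ℕ) → Bool) : Prop :=
  l.length = n ^ k ∧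
    ∀ u : Fin k → Fin n, l.getD (finFunctionFinEquiv u : ℕ) false = Z (fun j => (u j : ℕ))

/-- The open subset `⟦S⟧` of `X_k` generated by a set `S` of coded arrays. -/
def openClK {k : ℕ} (S : Set (ℕ × List Bool)) : Set ((Fin k → ℕ) → Bool) :=
  {Z | ∃ p ∈ S, ArrayAgrees p.1 p.2 Z}

/-- A set of coded arrays is computably enumerable. -/
def CEArrays (S : Set (ℕ × List Bool)) : Prop :=
  ∃ f : ℕ → Option (ℕ × List Bool), Computable f ∧ S = {σ | ∃ n, f n = some σ}

/-- A Π⁰₁ class in `X_k`: the complement of the open set generated by a c.e. set of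
arrays. -/
def Pi01ClassK {k : ℕ} (P : Set ((Fin k → ℕ) → Bool)) : Prop :=
  ∃ S : Set (ℕ × List Bool), CEArrays S ∧ P = (openClK S)ᶜ

/-- `μ` is the uniform (fair-coin) product measure on `X_k`: the cylinder determined by
an array of size `n` has measure `2^{-n^k}`. -/
def IsUniformMeasureK {k : ℕ} (μ : MeasureTheory.Measure ((Fin k → ℕ) → Bool)) : Prop :=
  ∀ (n : ℕ) (l : List Bool), l.length = n ^ k →
    μ {Z | ArrayAgrees n l Z} = 2⁻¹ ^ (n ^ k)

/-- `Z` is multiply recurrent in `P ⊆ X_k`: there is `n ≥ 1` with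
`Z ∈ ⋂_{1 ≤ i ≤ k} T_i^{-n} P`. -/
def MultiplyRecurrentK {k : ℕ} (P : Set ((Fin k → ℕ) → Bool))
    (Z : (Fin k → ℕ) → Bool) : Prop :=
  ∃ n : ℕ, 1 ≤ n ∧ Z ∈ ⋂ i : Fin k, (shiftK i)^[n] ⁻¹' P

/-- `Z ∈ X_k` is weakly (Kurtz) random w.r.t. `μ`: it belongs to no Π⁰₁ class of
measure `0`. -/
def KurtzRandomK {k : ℕ} (μ : MeasureTheory.Measure ((Fin k → ℕ) → Bool))
    (Z : (Fin k → ℕ) → Bool) : Prop :=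
  ∀ P : Set ((Fin k → ℕ) → Bool), Pi01ClassK P → μ P = 0 → Z ∉ P

section Computability

open Encodable Denumerable

variable {α β σ : Type*} [Primcodable α] [Primcodable β] [Primcodable σ]

theorem Computable.exists_nat_find {p : α → ℕ → Bool} (hp : Computable₂ p)
    (h : ∀ a, ∃ n, p a n = true) :
    ∃ f : α → ℕ, Computable f ∧ ∀ a, p a (f a) = true ∧ ∀ m < f a, p a m = false := by
  classical
  refine ⟨fun a => Nat.find (h a), ?_, fun a => ⟨Nat.find_spec (h a), fun m hm => ?_⟩⟩
  · refine Partrec.of_eq_tot (Partrec.rfind hp.partrec₂) fun a => ?_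
    refine Nat.mem_rfind.2 ⟨?_, fun {m} hm => ?_⟩
    · simpa using Nat.find_spec (h a)
    · simpa using Nat.find_min (h a) hm
  · simpa using Nat.find_min (h a) hm

theorem Rat.encodable_encode_eq (r : ℚ) :
    @encode ℚ Rat.instEncodable r = Nat.pair (encode r.num) r.den := by
  rfl

theorem Int.natAbs_eq_encode (z : ℤ) : z.natAbs = (encode z + 1) / 2 := by
  cases z with
  | ofNat n =>
    change n = (2 * n + 1) / 2
    omega
  | negSucc n =>
    change n + 1 = (2 * n + 1 + 1) / 2
    omega

theorem Int.toNat_eq_encode (z : ℤ) :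
    z.toNat = bif (encode z).bodd then 0 else (encode z).div2 := by
  cases z with
  | ofNat n =>
    change n = bif (2 * n).bodd then 0 else (2 * n).div2
    simp
  | negSucc n =>
    change 0 = bif (2 * n + 1).bodd then 0 else (2 * n + 1).div2
    simp

theorem Nat.coprime_iff_bounded (a b : ℕ) :
    Nat.Coprime a b ↔ ∀ t < a + b + 3, ¬ (2 ≤ t ∧ a % t = 0 ∧ b % t = 0) := by
  constructor
  · rintro h t - ⟨h2, ha, hb⟩
    have := Nat.dvd_gcd (Nat.dvd_of_mod_eq_zero ha) (Nat.dvd_of_mod_eq_zero hb)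
    rw [Nat.Coprime] at h
    rw [h, Nat.dvd_one] at this
    omega
  · intro h
    by_contra hc
    have hc' : a.gcd b ≠ 1 := hc
    rcases Nat.eq_zero_or_pos (a.gcd b) with h0 | h0
    · rw [Nat.gcd_eq_zero_iff] at h0
      exact h 2 (by omega) (by simp [h0.1, h0.2])
    · have hle : a.gcd b ≤ a + b := by
        rcases Nat.eq_zero_or_pos a with rfl | ha
        · simp
        · exact (Nat.gcd_le_left b ha).trans (Nat.le_add_right a b)
      refine h (a.gcd b) (by omega) ⟨by omega, Nat.mod_eq_zero_of_dvd (Nat.gcd_dvd_left _ _),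
        Nat.mod_eq_zero_of_dvd (Nat.gcd_dvd_right _ _)⟩

theorem Rat.mem_range_encode_iff (c : ℕ) :
    c ∈ Set.range (@encode ℚ Rat.instEncodable) ↔
      0 < c.unpair.2 ∧ Nat.Coprime ((c.unpair.1 + 1) / 2) c.unpair.2 := by
  constructor
  · rintro ⟨r, rfl⟩
    rw [Rat.encodable_encode_eq]
    simp only [Nat.unpair_pair, ← Int.natAbs_eq_encode]
    exact ⟨r.den_pos, r.reduced⟩
  · rintro ⟨h1, h2⟩
    refine ⟨⟨Denumerable.ofNat ℤ c.unpair.1, c.unpair.2, h1.ne', ?_⟩, ?_⟩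
    · rwa [Int.natAbs_eq_encode, Denumerable.encode_ofNat]
    · rw [Rat.encodable_encode_eq]
      simp only [Denumerable.encode_ofNat, Nat.pair_unpair]

theorem Rat.primrecPred_mem_range_encode :
    PrimrecPred fun c => c ∈ Set.range (@encode ℚ Rat.instEncodable) := by
  have h2 : Primrec fun c : ℕ => c.unpair.2 := Primrec.snd.comp .unpair
  have h1 : Primrec fun c : ℕ => (c.unpair.1 + 1) / 2 :=
    Primrec.nat_div.comp (Primrec.succ.comp (Primrec.fst.comp .unpair)) (.const 2)
  have h3 : Primrec fun c : ℕ => (c.unpair.1 + 1) / 2 + c.unpair.2 + 3 :=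
    Primrec.nat_add.comp (Primrec.nat_add.comp h1 h2) (.const 3)
  have hR : PrimrecRel fun t c : ℕ =>
      ¬ (2 ≤ t ∧ (c.unpair.1 + 1) / 2 % t = 0 ∧ c.unpair.2 % t = 0) := by
    refine PrimrecPred.not ((Primrec.nat_le.comp (.const 2) .fst).and (.and ?_ ?_))
    · exact Primrec.eq.comp (Primrec.nat_mod.comp (h1.comp .snd) .fst) (.const 0)
    · exact Primrec.eq.comp (Primrec.nat_mod.comp (h2.comp .snd) .fst) (.const 0)
  refine ((Primrec.nat_lt.comp (.const 0) h2).and (PrimrecRel.comp (PrimrecRel.forall_lt hR)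
    (f := fun c => (c.unpair.1 + 1) / 2 + c.unpair.2 + 3) h3 .id)).of_eq fun c => ?_
  rw [Rat.mem_range_encode_iff, Nat.coprime_iff_bounded]
  rfl

theorem Rat.computable_encodable_encode : Computable (@encode ℚ Rat.instEncodable) := by
  let : DecidablePred fun x => x ∈ Set.range (@encode ℚ Rat.instEncodable) :=
     Encodable.decidableRangeEncode ℚ
  have : Infinite (Set.range (@encode ℚ Rat.instEncodable)) :=
    Infinite.of_injective _ (Equiv.ofInjective _ encode_injective).injective
  let s := Set.range (@encode ℚ Rat.instEncodable)
  have key : ∀ n, @encode ℚ Rat.instEncodable (Denumerable.ofNat ℚ n) =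
      (Nat.Subtype.ofNat s n : ℕ) := by
    intro n
    have : Denumerable.ofNat ℚ n = (Encodable.equivRangeEncode ℚ).symm (Nat.Subtype.ofNat s n) := by
      with_unfolding_all rfl
    rw [this]
    exact congrArg Subtype.val ((Encodable.equivRangeEncode ℚ).apply_symm_apply _)
  have hv : Computable fun c => decide (c ∈ s) :=
    (primrecPred_iff_primrec_decide.1 Rat.primrecPred_mem_range_encode).to_comp
  have hadd : Computable₂ fun x m : ℕ => x + m + 1 :=
    Computable.succ.comp (Primrec.nat_add.to_comp.comp .fst .snd)
  obtain ⟨g, hg, hg'⟩ := Computable.exists_nat_find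
    (p := fun x m => decide ((if x ∈ s then x else (Nat.Subtype.ofNat s 0 : ℕ)) + m + 1 ∈ s))
    (hv.comp (hadd.comp (Computable.of_eq (Computable.cond (hv.comp .fst) .fst
      (.const (Nat.Subtype.ofNat s 0 : ℕ))) fun p => by
        by_cases h : p.1 ∈ s <;> simp [h]) .snd)) (by
      intro x
      split_ifs with h
      · simpa using Nat.Subtype.exists_succ (⟨x, h⟩ : s)
      · simpa using Nat.Subtype.exists_succ (Nat.Subtype.ofNat s 0))
  have hofNat : Computable fun n => (Nat.Subtype.ofNat s n : ℕ) := by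
    refine Computable.of_eq (f := fun n => Nat.rec (motive := fun _ => ℕ)
      (Nat.Subtype.ofNat s 0 : ℕ) (fun _ x => x + g x + 1) n) ?_ fun n => ?_
    · exact Computable.nat_rec .id (.const _) (Computable.to₂ (f := fun p : ℕ × ℕ × ℕ =>
        p.2.2 + g p.2.2 + 1) (hadd.comp (Computable.snd.comp .snd)
        (hg.comp (Computable.snd.comp .snd))))
    · induction n with
      | zero => rfl
      | succ n ih =>
        simp only [] at ih ⊢
        rw [ih]
        have hm : (Nat.Subtype.ofNat s n : ℕ) ∈ s := (Nat.Subtype.ofNat s n).2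
        have := hg' (Nat.Subtype.ofNat s n)
        simp only [hm, if_true, decide_eq_true_eq, decide_eq_false_iff_not] at this
        change _ = (Nat.Subtype.ofNat s n : ℕ) +
          Nat.find (Nat.Subtype.exists_succ (Nat.Subtype.ofNat s n)) + 1
        rw [(Nat.find_eq_iff (Nat.Subtype.exists_succ (Nat.Subtype.ofNat s n))).2 this]
  refine Computable.of_eq (hofNat.comp (Computable.encode (α := ℚ))) fun r => ?_
  rw [← key, Denumerable.ofNat_encode]

theorem Rat.computable_encode_num : Computable fun r : ℚ => encode r.num :=
  (Computable.fst.comp (Computable.unpair.comp Rat.computable_encodable_encode)).of_eq fun r => by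
    rw [Rat.encodable_encode_eq, Nat.unpair_pair]

theorem Rat.computable_den : Computable fun r : ℚ => r.den :=
  (Computable.snd.comp (Computable.unpair.comp Rat.computable_encodable_encode)).of_eq fun r => by
    rw [Rat.encodable_encode_eq, Nat.unpair_pair]

theorem Rat.computable_toNat_num : Computable fun r : ℚ => r.num.toNat :=
  (Computable.cond (Computable.nat_bodd.comp Rat.computable_encode_num) (.const 0)
    (Computable.nat_div2.comp Rat.computable_encode_num)).of_eq fun _ =>
      (Int.toNat_eq_encode _).symm

theorem Computable.rat_div {f g : α → ℕ} (hf : Computable f) (hg : Computable g)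
    (h0 : ∀ a, 0 < g a) : Computable fun a => (f a : ℚ) / g a := by
  have hb : Computable fun r : ℚ => (encode r.num).bodd :=
    Computable.nat_bodd.comp Rat.computable_encode_num
  have hodd : ∀ z : ℤ, (encode z).bodd = false ↔ 0 ≤ z := by
    intro z
    cases z with
    | ofNat n =>
      change (2 * n).bodd = false ↔ _
      simp
    | negSucc n =>
      change (2 * n + 1).bodd = false ↔ _
      simp
  have hchar : ∀ a (r : ℚ), (!(encode r.num).bodd && decide (r.num.toNat * g a = f a * r.den)) =
      true ↔ r = (f a : ℚ) / g a := by
    intro a r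
    have hg0 : (g a : ℚ) ≠ 0 := by exact_mod_cast (h0 a).ne'
    have hd0 : (r.den : ℚ) ≠ 0 := by exact_mod_cast r.den_pos.ne'
    simp only [Bool.and_eq_true, Bool.not_eq_true', hodd, decide_eq_true_eq]
    rw [eq_div_iff hg0]
    have hr : r * g a = f a ↔ (r.num : ℚ) * g a = f a * r.den := by
      rw [← div_eq_iff hd0, mul_div_right_comm, Rat.num_div_den]
    rw [hr]
    constructor
    · rintro ⟨h1, h2⟩
      lift r.num to ℕ using h1 with n
      simp only [Int.toNat_natCast] at h2
      exact_mod_cast h2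
    · intro h
      have h' : r.num * g a = f a * r.den := by exact_mod_cast h
      have hn : 0 ≤ r.num := by
        by_contra hneg
        have h1 : r.num * g a < 0 := mul_neg_of_neg_of_pos (by omega) (by exact_mod_cast h0 a)
        have h2 : (0 : ℤ) ≤ f a * r.den := by positivity
        omega
      refine ⟨hn, ?_⟩
      lift r.num to ℕ using hn with n
      simp only [Int.toNat_natCast]
      exact_mod_cast h'
  obtain ⟨F, hF, hF'⟩ := Computable.exists_nat_find
    (p := fun a n => !(encode (Denumerable.ofNat ℚ n).num).bodd &&
      decide ((Denumerable.ofNat ℚ n).num.toNat * g a = f a * (Denumerable.ofNat ℚ n).den))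
    (by
      have ho : Computable fun p : α × ℕ => Denumerable.ofNat ℚ p.2 :=
        (Computable.ofNat ℚ).comp .snd
      refine Primrec.and.to_comp.comp (Primrec.not.to_comp.comp (hb.comp ho))
        (Primrec.eq.decide.to_comp.comp
          (Primrec.nat_mul.to_comp.comp (Rat.computable_toNat_num.comp ho) (hg.comp .fst))
          (Primrec.nat_mul.to_comp.comp (hf.comp .fst) (Rat.computable_den.comp ho))))
    (fun a => ⟨@encode ℚ Primcodable.toEncodable ((f a : ℚ) / g a), by
      have := Denumerable.ofNat_encode ((f a : ℚ) / g a)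
      exact (hchar a _).2 this⟩)
  exact ((Computable.ofNat ℚ).comp hF).of_eq fun a => (hchar a _).1 (hF' a).1

end Computability

section BoundedOperations

variable {α β : Type*} [Primcodable α] [Primcodable β]

theorem Computable.map_range {g : α → ℕ} {F : α → ℕ → β} (hg : Computable g)
    (hF : Computable₂ F) : Computable fun a => (List.range (g a)).map (F a) := by
  refine Computable.of_eq (f := fun a => Nat.rec (motive := fun _ => List β) []
    (fun i l => l ++ [F a i]) (g a)) ?_ fun a => ?_
  · exact Computable.nat_rec hg (.const _) (Computable.to₂ (f := fun p : α × ℕ × List β =>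
      p.2.2 ++ [F p.1 p.2.1]) (Computable.list_concat.comp (Computable.snd.comp .snd)
        (hF.comp .fst (Computable.fst.comp .snd))))
  · induction g a with
    | zero => rfl
    | succ n ih => simp_all [List.range_succ]

theorem Computable.sum_range {g : α → ℕ} {F : α → ℕ → ℕ} (hg : Computable g)
    (hF : Computable₂ F) : Computable fun a => ∑ i ∈ Finset.range (g a), F a i := by
  refine Computable.of_eq (f := fun a => Nat.rec (motive := fun _ => ℕ) 0
    (fun i s => s + F a i) (g a)) ?_ fun a => ?_
  · exact Computable.nat_rec hg (.const _) (Computable.to₂ (f := fun p : α × ℕ × ℕ =>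
      p.2.2 + F p.1 p.2.1) (Primrec.nat_add.to_comp.comp (Computable.snd.comp .snd)
        (hF.comp .fst (Computable.fst.comp .snd))))
  · induction g a with
    | zero => rfl
    | succ n ih => simp_all [Finset.sum_range_succ]

theorem Computable.exists_lt {g : α → ℕ} {F : α → ℕ → Bool} (hg : Computable g)
    (hF : Computable₂ F) : Computable fun a => decide (∃ i < g a, F a i = true) := by
  refine Computable.of_eq (f := fun a => Nat.rec (motive := fun _ => Bool) false
    (fun i s => s || F a i) (g a)) ?_ fun a => ?_
  · exact Computable.nat_rec hg (.const _) (Computable.to₂ (f := fun p : α × ℕ × Bool =>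
      p.2.2 || F p.1 p.2.1) (Primrec.or.to_comp.comp (Computable.snd.comp .snd)
        (hF.comp .fst (Computable.fst.comp .snd))))
  · induction g a with
    | zero => simp
    | succ n ih =>
      rw [Bool.eq_iff_iff]
      simp only [ih, Bool.or_eq_true, decide_eq_true_eq, Nat.exists_lt_succ_right]

theorem Computable.forall_lt {g : α → ℕ} {F : α → ℕ → Bool} (hg : Computable g)
    (hF : Computable₂ F) : Computable fun a => decide (∀ i < g a, F a i = true) := by
  refine Computable.of_eq (f := fun a => Nat.rec (motive := fun _ => Bool) true
    (fun i s => s && F a i) (g a)) ?_ fun a => ?_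
  · exact Computable.nat_rec hg (.const _) (Computable.to₂ (f := fun p : α × ℕ × Bool =>
      p.2.2 && F p.1 p.2.1) (Primrec.and.to_comp.comp (Computable.snd.comp .snd)
        (hF.comp .fst (Computable.fst.comp .snd))))
  · induction g a with
    | zero => simp
    | succ n ih =>
      rw [Bool.eq_iff_iff]
      simp only [ih, Bool.and_eq_true, decide_eq_true_eq, Nat.forall_lt_succ_right]

theorem Computable.exists_fin {k : ℕ} {F : Fin k → α → Bool} (hF : ∀ i, Computable (F i)) :
    Computable fun a => decide (∃ i, F i a = true) := by
  induction k with
  | zero => exact (Computable.const false).of_eq fun a => by simp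
  | succ k ih =>
    exact (Primrec.or.to_comp.comp (hF 0) (ih fun i => hF i.succ)).of_eq fun a => by
      simp [Fin.exists_fin_succ]

theorem Computable.sum_fin {k : ℕ} {F : Fin k → α → ℕ} (hF : ∀ i, Computable (F i)) :
    Computable fun a => ∑ i, F i a := by
  induction k with
  | zero => exact (Computable.const 0).of_eq fun a => by simp
  | succ k ih =>
    exact (Primrec.nat_add.to_comp.comp (hF 0) (ih fun i => hF i.succ)).of_eq fun a => by
      simp [Fin.sum_univ_succ]

theorem Computable.nat_pow {f g : α → ℕ} (hf : Computable f) (hg : Computable g) :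
    Computable fun a => f a ^ g a :=
  (Primrec₂.unpaired'.1 Nat.Primrec.pow).to_comp.comp hf hg

theorem Computable.nat_lt {f g : α → ℕ} (hf : Computable f) (hg : Computable g) :
    Computable fun a => decide (f a < g a) :=
  Primrec.nat_lt.decide.to_comp.comp hf hg

theorem Computable.testBit {f g : α → ℕ} (hf : Computable f) (hg : Computable g) :
    Computable fun a => (f a).testBit (g a) :=
  (Primrec.eq.decide.to_comp.comp (Primrec.nat_mod.to_comp.comp (Primrec.nat_div.to_comp.comp hf
    (Computable.nat_pow (.const 2) hg)) (.const 2)) (.const 1)).of_eq fun a => by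
      rw [Nat.testBit_eq_decide_div_mod_eq]

end BoundedOperations

section CountingStrings

/-- The initial segment of length `L` of an infinite binary sequence. -/
def initSeg (X : ℕ → Bool) (L : ℕ) : List Bool := (List.range L).map X

/-- The number of strings of length `L` satisfying `b`. -/
def countStrings (b : List Bool → Bool) (L : ℕ) : ℕ :=
  ∑ c ∈ Finset.range (2 ^ L), (b (initSeg c.testBit L)).toNat

@[simp]
theorem length_initSeg (X : ℕ → Bool) (L : ℕ) : (initSeg X L).length = L := by
  simp [initSeg]

theorem getD_initSeg (X : ℕ → Bool) {L i : ℕ} (h : i < L) : (initSeg X L).getD i false = X i := by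
  simp [initSeg, h]

theorem isPrefixOf_iff (σ : List Bool) (X : ℕ → Bool) :
    IsPrefixOf σ X ↔ σ = initSeg X σ.length := by
  constructor
  · intro h
    refine List.ext_getElem (by simp) fun i h1 h2 => ?_
    have := h i h1
    rw [List.getD_eq_getElem _ _ h1] at this
    simpa [initSeg] using this
  · intro h i hi
    rw [h]
    exact getD_initSeg X hi

theorem initSeg_isPrefixOf (X : ℕ → Bool) (L : ℕ) : IsPrefixOf (initSeg X L) X := by
  simp [isPrefixOf_iff]

theorem initSeg_eq_iff {X Y : ℕ → Bool} {L : ℕ} :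
    initSeg X L = initSeg Y L ↔ ∀ i < L, X i = Y i := by
  simp [initSeg, List.map_inj_left]

theorem initSeg_prefix (X : ℕ → Bool) {L M : ℕ} (h : L ≤ M) : initSeg X L <+: initSeg X M := by
  obtain ⟨d, rfl⟩ := Nat.exists_eq_add_of_le h
  rw [initSeg, initSeg, List.range_add, List.map_append]
  exact List.prefix_append _ _

theorem Computable.countStrings {α : Type*} [Primcodable α] {b : α → List Bool → Bool}
    {g : α → ℕ} (hb : Computable₂ b) (hg : Computable g) :
    Computable fun a => countStrings (b a) (g a) := by
  have h1 : Computable fun p : α × ℕ => initSeg p.2.testBit (g p.1) :=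
    Computable.map_range (F := fun p : α × ℕ => p.2.testBit) (hg.comp .fst)
      (Computable.testBit (Computable.snd.comp .fst) .snd)
  refine Computable.sum_range (Computable.nat_pow (.const 2) hg) (Computable.to₂
    (f := fun p : α × ℕ => (b p.1 (initSeg p.2.testBit (g p.1))).toNat) ?_)
  exact (Primrec.dom_bool Bool.toNat).to_comp.comp (hb.comp .fst h1)

theorem measurableSet_initSeg (p : List Bool → Prop) (L : ℕ) :
    MeasurableSet {X : ℕ → Bool | p (initSeg X L)} := by
  have hr : Measurable fun (X : ℕ → Bool) (i : Fin L) => X i := by fun_prop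
  have : {X : ℕ → Bool | p (initSeg X L)} =
      (fun (X : ℕ → Bool) (i : Fin L) => X i) ⁻¹' {f | p (List.ofFn f)} := by
    ext X
    simp only [Set.mem_preimage, Set.mem_ofPred_eq, initSeg, List.ofFn_eq_map]
    rw [← List.map_coe_finRange_eq_range, List.map_map]
    rfl
  rw [this]
  exact hr (Set.toFinite _).measurableSet

theorem IsUniformMeasure.measure_initSeg {ν : Measure (ℕ → Bool)} (hν : IsUniformMeasure ν)
    (b : List Bool → Bool) (L : ℕ) :
    ν {X | b (initSeg X L) = true} = countStrings b L / 2 ^ L := by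
  have hset : {X : ℕ → Bool | b (initSeg X L) = true} =
      ⋃ c ∈ (Finset.range (2 ^ L)).filter fun c => b (initSeg c.testBit L) = true,
        {X | IsPrefixOf (initSeg c.testBit L) X} := by
    ext X
    simp only [Set.mem_ofPred_eq, Set.mem_iUnion, Finset.mem_filter, Finset.mem_range, exists_prop]
    constructor
    · intro h
      have heq : initSeg (Nat.ofBits fun i : Fin L => X i).testBit L = initSeg X L :=
        initSeg_eq_iff.2 fun i hi => by rw [Nat.testBit_ofBits_lt _ _ hi]
      exact ⟨Nat.ofBits fun i : Fin L => X i, ⟨Nat.ofBits_lt_two_pow _, by rwa [heq]⟩,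
        by rw [heq]; exact initSeg_isPrefixOf X L⟩
    · rintro ⟨c, ⟨-, hb⟩, hX⟩
      rw [isPrefixOf_iff, length_initSeg] at hX
      rwa [← hX]
  rw [hset, measure_biUnion_finset]
  · rw [Finset.sum_congr rfl fun c _ => hν _]
    simp only [length_initSeg]
    rw [Finset.sum_const, countStrings, Finset.card_filter]
    simp only [nsmul_eq_mul, ENNReal.div_eq_inv_mul, ENNReal.inv_pow, Bool.toNat]
    rw [mul_comm]
    congr 2
    exact Finset.sum_congr rfl fun c _ => by cases b (initSeg c.testBit L) <;> rfl
  · intro c hc d hd hcd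
    refine Set.disjoint_left.2 fun X hX hX' => hcd ?_
    simp only [Finset.coe_filter, Finset.mem_range, Set.mem_ofPred_eq] at hc hd hX hX'
    rw [isPrefixOf_iff, length_initSeg] at hX hX'
    have := initSeg_eq_iff.1 (hX.trans hX'.symm)
    refine Nat.eq_of_testBit_eq fun i => ?_
    rcases lt_or_ge i L with hi | hi
    · exact this i hi
    · rw [Nat.testBit_lt_two_pow (hc.1.trans_le (Nat.pow_le_pow_right two_pos hi)),
        Nat.testBit_lt_two_pow (hd.1.trans_le (Nat.pow_le_pow_right two_pos hi))]
  · exact fun c _ => by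
      simp_rw [isPrefixOf_iff, length_initSeg]
      exact measurableSet_initSeg (fun τ => initSeg c.testBit L = τ) L

end CountingStrings

section FairCoin

/-- The law of a fair coin. -/
noncomputable def fairCoin : Measure Bool := (PMF.uniformOfFintype Bool).toMeasure

instance : IsProbabilityMeasure fairCoin := by
  unfold fairCoin; infer_instance

theorem fairCoin_singleton (b : Bool) : fairCoin {b} = 2⁻¹ := by
  rw [fairCoin, PMF.toMeasure_apply_singleton _ _ (measurableSet_singleton b)]
  simp

theorem eq_infinitePi_fairCoin {ι : Type*} (ρ : Measure (ι → Bool)) (F : ℕ → Finset ι)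
    (hF : ∀ I : Finset ι, ∃ n, I ⊆ F n)
    (h : ∀ (n : ℕ) (g : ι → Bool), ρ {X | ∀ i ∈ F n, X i = g i} = 2⁻¹ ^ (F n).card) :
    ρ = Measure.infinitePi fun _ => fairCoin := by
  classical
  have hbox (n : ℕ) : ρ.map (F n).restrict = Measure.pi fun _ : F n => fairCoin := by
    refine Measure.ext_of_singleton fun g => ?_
    rw [Measure.map_apply (Finset.measurable_restrict _) (measurableSet_singleton g),
      Measure.pi_singleton]
    have := h n fun i => if hi : i ∈ F n then g ⟨i, hi⟩ else false
    simp only [fairCoin_singleton, Finset.prod_const, Finset.card_univ, Fintype.card_coe]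
    rw [← this]
    congr 1
    ext X
    simp only [Set.mem_preimage, Set.mem_singleton_iff, funext_iff, Finset.restrict,
      Subtype.forall, Set.mem_ofPred_eq]
    exact forall₂_congr fun i hi => by simp [hi]
  refine IsProjectiveLimit.unique (P := fun I : Finset ι => Measure.pi fun _ : I => fairCoin) ?_
    (Measure.isProjectiveLimit_infinitePi _)
  intro I
  obtain ⟨n, hn⟩ := hF I
  rw [isProjectiveMeasureFamily_pi (fun _ : ι => fairCoin) (F n) I hn]
  simp only
  rw [← hbox n, Measure.map_map (Finset.measurable_restrict₂ hn) (Finset.measurable_restrict _)]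
  rfl

theorem IsUniformMeasure.eq_infinitePi {ν : Measure (ℕ → Bool)} (hν : IsUniformMeasure ν) :
    ν = Measure.infinitePi fun _ => fairCoin := by
  refine eq_infinitePi_fairCoin ν Finset.range (fun I => ?_) fun n g => ?_
  · obtain ⟨n, hn⟩ := I.bddAbove
    exact ⟨n + 1, fun i hi => Finset.mem_range.2 (Nat.lt_succ_of_le (hn hi))⟩
  · have := hν (initSeg g n)
    rw [length_initSeg] at this
    rw [Finset.card_range, ← this]
    congr 1
    ext X
    simp only [Set.mem_ofPred_eq, isPrefixOf_iff, length_initSeg, initSeg_eq_iff, Finset.mem_range]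
    exact forall₂_congr fun _ _ => eq_comm

theorem IsUniformMeasureK.eq_infinitePi {k : ℕ} {μ : Measure ((Fin k → ℕ) → Bool)}
    (hμ : IsUniformMeasureK μ) : μ = Measure.infinitePi fun _ => fairCoin := by
  refine eq_infinitePi_fairCoin μ (fun n => Fintype.piFinset fun _ => Finset.range n)
    (fun I => ?_) fun n g => ?_
  · refine ⟨(∑ u ∈ I, ∑ i, u i) + 1, fun u hu => Fintype.mem_piFinset.2 fun i => ?_⟩
    rw [Finset.mem_range, Nat.lt_succ_iff]
    exact (Finset.single_le_sum (f := u) (fun _ _ => Nat.zero_le _) (Finset.mem_univ i)).trans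
      (Finset.single_le_sum (f := fun u : Fin k → ℕ => ∑ i, u i) (fun _ _ => Nat.zero_le _) hu)
  · have := hμ n (List.ofFn fun c : Fin (n ^ k) => g fun j => (finFunctionFinEquiv.symm c j : ℕ))
      (by simp)
    rw [Fintype.card_piFinset, Finset.prod_const, Finset.card_range, Finset.card_fin, ← this]
    have hget (u : Fin k → Fin n) : (List.ofFn fun c : Fin (n ^ k) =>
        g fun j => (finFunctionFinEquiv.symm c j : ℕ)).getD (finFunctionFinEquiv u : ℕ) false =
          g fun j => (u j : ℕ) := by
      rw [List.getD_eq_getElem _ _ (by simp only [List.length_ofFn, Fin.is_lt]), List.getElem_ofFn,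
        Fin.eta, Equiv.symm_apply_apply]
    congr 1
    ext X
    simp only [Set.mem_ofPred_eq, ArrayAgrees, List.length_ofFn, true_and, Fintype.mem_piFinset,
      Finset.mem_range]
    simp only [hget]
    exact ⟨fun H u => (H _ fun i => (u i).2).symm, fun H u hu => (H fun i => ⟨u i, hu i⟩).symm⟩

theorem infinitePi_fairCoin_preimage_comp {ι κ : Type*} {f : κ → ι} (hf : f.Injective)
    {A : Set (κ → Bool)} (hA : MeasurableSet A) :
    Measure.infinitePi (fun _ : ι => fairCoin) {X | X ∘ f ∈ A} =
      Measure.infinitePi (fun _ : κ => fairCoin) A := by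
  rw [← Measure.map_infinitePi_infinitePi_of_inj (P := fun _ : ι => fairCoin) hf,
    Measure.map_apply (by fun_prop) hA]
  rfl

/-- Events determined by pairwise disjoint finite sets of coordinates are independent. -/
theorem infinitePi_fairCoin_biInter {ι κ : Type*} [DecidableEq ι] (A : κ → Set (ι → Bool))
    (S : κ → Finset ι) (t : Finset κ)
    (hA : ∀ a ∈ t, ∀ X Y : ι → Bool, (∀ i ∈ S a, X i = Y i) → X ∈ A a → Y ∈ A a)
    (hS : (t : Set κ).PairwiseDisjoint S) :
    Measure.infinitePi (fun _ : ι => fairCoin) (⋂ a ∈ t, A a) =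
      ∏ a ∈ t, Measure.infinitePi (fun _ : ι => fairCoin) (A a) := by
  classical
  have key (B : Set (ι → Bool)) (T : Finset ι)
      (hB : ∀ X Y : ι → Bool, (∀ i ∈ T, X i = Y i) → X ∈ B → Y ∈ B) :
      B = T.restrict ⁻¹' {g | ∃ X ∈ B, T.restrict X = g} := by
    ext Y
    constructor
    · exact fun hY => ⟨Y, hY, rfl⟩
    · rintro ⟨X, hX, hXY⟩
      exact hB X Y (fun i hi => congrFun hXY ⟨i, hi⟩) hX
  induction t using Finset.induction_on with
  | empty => simp
  | insert a t ha ih =>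
    rw [Finset.prod_insert ha, ← ih (fun b hb => hA b (Finset.mem_insert_of_mem hb))
      (hS.subset (by simp)), Finset.set_biInter_insert]
    have h1 := key (A a) (S a) (hA a (Finset.mem_insert_self _ _))
    have h2 := key (⋂ b ∈ t, A b) (t.biUnion S) fun X Y hXY hX => by
      simp only [Set.mem_iInter] at hX ⊢
      exact fun b hb => hA b (Finset.mem_insert_of_mem hb) X Y
        (fun i hi => hXY i (Finset.mem_biUnion.2 ⟨b, hb, hi⟩)) (hX b hb)
    have hind := ProbabilityTheory.iIndepFun_infinitePi (P := fun _ : ι => fairCoin)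
      (X := fun _ b => b) fun _ => measurable_id
    have hdis : Disjoint (S a) (t.biUnion S) := by
      rw [Finset.disjoint_biUnion_right]
      exact fun b hb => hS (by simp) (by simp [hb]) (fun h => ha (h ▸ hb))
    have := (hind.indepFun_finset (S a) (t.biUnion S) hdis fun i => by fun_prop)
    rw [h1, h2]
    exact this.measure_inter_preimage_eq_mul _ _ (Set.toFinite _).measurableSet
      (Set.toFinite _).measurableSet

end FairCoin

section Pullback

/-- The open set of sequences having an initial segment accepted by `b`. -/
def openOf (b : List Bool → Bool) : Set (ℕ → Bool) := {X | ∃ L, b (initSeg X L) = true}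

/-- The string `τ` already witnesses that `X ∘ g ∈ openOf b` for all `X` extending `τ`. -/
def pull (b : List Bool → Bool) (g : ℕ → ℕ) (τ : List Bool) : Bool :=
  decide (∃ M < τ.length + 1, (decide (∀ x < M, decide (g x < τ.length) = true) &&
    b ((List.range M).map fun x => τ.getD (g x) false)) = true)

/-- The string `τ` witnesses that for every `j < J` some `X ∘ h i (n j)` is in `openOf b`. -/
def hitAll {k : ℕ} (b : List Bool → Bool) (h : Fin k → ℕ → ℕ → ℕ) (n : ℕ → ℕ) (J : ℕ)
    (τ : List Bool) : Bool :=
  decide (∀ j < J, decide (∃ i, pull b (h i (n j)) τ = true) = true)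

/-- The sequences `X` such that for every `j < J` some `X ∘ h i (n j)` is in `A`. -/
def hitSet {k : ℕ} (A : Set (ℕ → Bool)) (h : Fin k → ℕ → ℕ → ℕ) (n : ℕ → ℕ) (J : ℕ) :
    Set (ℕ → Bool) :=
  {X | ∀ j < J, ∃ i, X ∘ h i (n j) ∈ A}

variable {k : ℕ} {b : List Bool → Bool} {g : ℕ → ℕ} {h : Fin k → ℕ → ℕ → ℕ} {n : ℕ → ℕ} {J : ℕ}

theorem map_getD_initSeg {X : ℕ → Bool} {M L : ℕ} (hg : ∀ x < M, g x < L) :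
    ((List.range M).map fun x => (initSeg X L).getD (g x) false) = initSeg (X ∘ g) M :=
  List.map_congr_left fun x hx => getD_initSeg X (hg x (List.mem_range.1 hx))

theorem pull_initSeg {X : ℕ → Bool} {L : ℕ} :
    pull b g (initSeg X L) = true ↔ ∃ M ≤ L, (∀ x < M, g x < L) ∧ b (initSeg (X ∘ g) M) = true := by
  simp only [pull, length_initSeg, Bool.and_eq_true, decide_eq_true_eq, Nat.lt_succ_iff]
  refine exists_congr fun M => and_congr_right fun _ => and_congr_right fun hM => ?_
  rw [map_getD_initSeg hM]

theorem exists_pull_initSeg {X : ℕ → Bool} (hX : X ∘ g ∈ openOf b) :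
    ∃ L₁, ∀ L ≥ L₁, pull b g (initSeg X L) = true := by
  obtain ⟨M, hM⟩ := hX
  refine ⟨M + ∑ x ∈ Finset.range M, (g x + 1), fun L hL => pull_initSeg.2
    ⟨M, by omega, fun x hx => ?_, hM⟩⟩
  have := Finset.single_le_sum (f := fun x => g x + 1) (fun _ _ => Nat.zero_le _)
    (Finset.mem_range.2 hx)
  omega

theorem hitAll_iff {τ : List Bool} :
    hitAll b h n J τ = true ↔ ∀ j < J, ∃ i, pull b (h i (n j)) τ = true := by
  simp [hitAll]

theorem openCl_hitAll :
    openCl {τ | hitAll b h n J τ = true} = hitSet (openOf b) h n J := by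
  ext X
  constructor
  · rintro ⟨τ, hτ, hX⟩ j hj
    rw [isPrefixOf_iff] at hX
    obtain ⟨i, hi⟩ := hitAll_iff.1 hτ j hj
    rw [hX] at hi
    obtain ⟨M, -, -, hM⟩ := pull_initSeg.1 hi
    exact ⟨i, M, hM⟩
  · intro hX
    have : ∀ j, ∃ L₁, j < J → ∀ L ≥ L₁, ∃ i, pull b (h i (n j)) (initSeg X L) = true := by
      intro j
      by_cases hj : j < J
      · obtain ⟨i, hi⟩ := hX j hj
        obtain ⟨L₁, hL₁⟩ := exists_pull_initSeg hi
        exact ⟨L₁, fun _ L hL => ⟨i, hL₁ L hL⟩⟩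
      · exact ⟨0, fun h => absurd h hj⟩
    choose L₁ hL₁ using this
    refine ⟨initSeg X (∑ j ∈ Finset.range J, L₁ j), hitAll_iff.2 fun j hj => hL₁ j hj _ ?_,
      initSeg_isPrefixOf _ _⟩
    exact Finset.single_le_sum (fun _ _ => Nat.zero_le _) (Finset.mem_range.2 hj)

theorem Computable.pull {α : Type*} [Primcodable α] {g : α → ℕ → ℕ} {τ : α → List Bool}
    (hb : Computable b) (hg : Computable₂ g) (hτ : Computable τ) :
    Computable fun a => pull b (g a) (τ a) := by
  have hlen : Computable fun a => (τ a).length := Computable.list_length.comp hτ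
  refine Computable.exists_lt (Computable.succ.comp hlen) (Computable.to₂ (f := fun p : α × ℕ =>
    decide (∀ x < p.2, decide (g p.1 x < (τ p.1).length) = true) &&
      b ((List.range p.2).map fun x => (τ p.1).getD (g p.1 x) false)) ?_)
  refine Primrec.and.to_comp.comp (Computable.forall_lt .snd (Computable.to₂
    (f := fun q : (α × ℕ) × ℕ => decide (g q.1.1 q.2 < (τ q.1.1).length))
    (Computable.nat_lt (hg.comp (Computable.fst.comp .fst) .snd)
      (hlen.comp (Computable.fst.comp .fst))))) ?_
  refine hb.comp (Computable.map_range .snd (Computable.to₂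
    (f := fun q : (α × ℕ) × ℕ => (τ q.1.1).getD (g q.1.1 q.2) false) ?_))
  exact (Primrec.list_getD false).to_comp.comp (hτ.comp (Computable.fst.comp .fst))
    (hg.comp (Computable.fst.comp .fst) .snd)

theorem Computable.hitAll {α : Type*} [Primcodable α] {n : α → ℕ → ℕ} {J : α → ℕ}
    {τ : α → List Bool} (hb : Computable b) (hh : ∀ i, Computable fun p : ℕ × ℕ => h i p.1 p.2)
    (hn : Computable₂ n) (hJ : Computable J) (hτ : Computable τ) :
    Computable fun a => hitAll b h (n a) (J a) (τ a) := by
  refine Computable.forall_lt hJ (Computable.to₂ (f := fun p : α × ℕ =>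
    decide (∃ i, _root_.pull b (h i (n p.1 p.2)) (τ p.1) = true)) ?_)
  refine Computable.exists_fin fun i => Computable.pull hb (Computable.to₂
    (f := fun q : (α × ℕ) × ℕ => h i (n q.1.1 q.1.2) q.2) ?_) (hτ.comp .fst)
  exact (hh i).comp ((hn.comp (Computable.fst.comp .fst) (Computable.snd.comp .fst)).pair .snd)

end Pullback

section HitMeasure

variable {k : ℕ} {b : List Bool → Bool} {g : ℕ → ℕ} {h : Fin k → ℕ → ℕ → ℕ} {n : ℕ → ℕ} {J L : ℕ}
  {ν : Measure (ℕ → Bool)}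

theorem measurableSet_openOf (b : List Bool → Bool) : MeasurableSet (openOf b) := by
  have : openOf b = ⋃ L, {X | b (initSeg X L) = true} := by
    ext X; simp [openOf]
  rw [this]
  exact MeasurableSet.iUnion fun L => measurableSet_initSeg (fun τ => b τ = true) L

theorem IsUniformMeasure.isProbabilityMeasure (hν : IsUniformMeasure ν) :
    IsProbabilityMeasure ν := by
  rw [hν.eq_infinitePi]; infer_instance

theorem IsUniformMeasure.real_preimage_comp (hν : IsUniformMeasure ν) (hg : g.Injective)
    {A : Set (ℕ → Bool)} (hA : MeasurableSet A) : ν.real {X | X ∘ g ∈ A} = ν.real A := by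
  rw [hν.eq_infinitePi, measureReal_def, measureReal_def, infinitePi_fairCoin_preimage_comp hg hA]

theorem IsUniformMeasure.real_iUnion_preimage_comp_le (hν : IsUniformMeasure ν)
    (hinj : ∀ i j, (h i (n j)).Injective) {D : Set (ℕ → Bool)} (hD : MeasurableSet D) :
    ν.real (⋃ j ∈ Finset.range J, ⋃ i, {X | X ∘ h i (n j) ∈ D}) ≤ J * k * ν.real D := by
  have := hν.isProbabilityMeasure
  refine (measureReal_biUnion_finset_le _ _).trans ?_
  refine (Finset.sum_le_sum (g := fun _ => k * ν.real D) fun j _ => ?_).trans ?_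
  · refine (measureReal_iUnion_fintype_le _).trans ?_
    rw [Finset.sum_congr rfl fun i _ => hν.real_preimage_comp (hinj i j) hD]
    simp
  · simp [mul_assoc]

theorem hitSet_subset {A O : Set (ℕ → Bool)} {V : Set (ℕ → Bool)} (hV : hitSet A h n J ⊆ V) :
    hitSet O h n J ⊆ V ∪ ⋃ j ∈ Finset.range J, ⋃ i, {X | X ∘ h i (n j) ∈ O \ A} := by
  intro X hX
  by_contra hc
  simp only [Set.mem_union, Set.mem_iUnion, not_or, not_exists, Finset.mem_range] at hc
  refine hc.1 (hV fun j hj => ?_)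
  obtain ⟨i, hi⟩ := hX j hj
  exact ⟨i, by_contra fun hA => hc.2 j hj i ⟨hi, hA⟩⟩

theorem IsUniformMeasure.abs_real_hitSet_sub_le (hν : IsUniformMeasure ν)
    (hinj : ∀ i j, (h i (n j)).Injective) {L' : ℕ} (hL : L ≤ L')
    (hL' : ∀ j < J, ∀ i, ∀ x < L, h i (n j) x < L') :
    |ν.real (hitSet (openOf b) h n J) - ν.real {X | hitAll b h n J (initSeg X L') = true}| ≤
      J * k * ν.real (openOf b \ {X | b (initSeg X L) = true}) := by
  have := hν.isProbabilityMeasure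
  have hm : MeasurableSet (openOf b \ {X | b (initSeg X L) = true}) :=
    (measurableSet_openOf b).diff (measurableSet_initSeg (fun τ => b τ = true) L)
  have h1 : {X | hitAll b h n J (initSeg X L') = true} ⊆ hitSet (openOf b) h n J := by
    rw [← openCl_hitAll]
    exact fun X hX => ⟨_, hX, initSeg_isPrefixOf _ _⟩
  have h2 : hitSet {X | b (initSeg X L) = true} h n J ⊆
      {X | hitAll b h n J (initSeg X L') = true} := by
    intro X hX
    refine hitAll_iff.2 fun j hj => ?_
    obtain ⟨i, hi⟩ := hX j hj
    exact ⟨i, pull_initSeg.2 ⟨L, hL, hL' j hj i, hi⟩⟩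
  rw [abs_of_nonneg (sub_nonneg.2 (measureReal_mono h1)), sub_le_iff_le_add']
  exact (measureReal_mono (hitSet_subset h2)).trans ((measureReal_union_le _ _).trans
    (add_le_add_right (hν.real_iUnion_preimage_comp_le hinj hm) _))

theorem IsUniformMeasure.real_hitSet_initSeg (hν : IsUniformMeasure ν)
    (hinj : ∀ i j, (h i (n j)).Injective)
    (hdis : ∀ j < J, ∀ i, ∀ x < L, ∀ j' < J, ∀ i', ∀ x' < L,
      h i (n j) x = h i' (n j') x' → j = j' ∧ i = i') :
    ν.real (hitSet {X | b (initSeg X L) = true} h n J) =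
      (1 - (1 - ν.real {X | b (initSeg X L) = true}) ^ k) ^ J := by
  have := hν.isProbabilityMeasure
  set A : Set (ℕ → Bool) := {X | b (initSeg X L) = true} with hAdef
  have hA : MeasurableSet A := measurableSet_initSeg (fun τ => b τ = true) L
  set D : ℕ → Fin k → Finset ℕ := fun j i => (Finset.range L).image (h i (n j)) with hD
  have hdet (j : ℕ) (i : Fin k) (X Y : ℕ → Bool) (hXY : ∀ x ∈ D j i, X x = Y x) :
      X ∘ h i (n j) ∈ A ↔ Y ∘ h i (n j) ∈ A := by
    have : initSeg (X ∘ h i (n j)) L = initSeg (Y ∘ h i (n j)) L :=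
      initSeg_eq_iff.2 fun x hx => hXY _ (Finset.mem_image_of_mem _ (Finset.mem_range.2 hx))
    simp only [hAdef, Set.mem_ofPred_eq, this]
  have hDdis (j : ℕ) (hj : j < J) (j' : ℕ) (hj' : j' < J) (i i' : Fin k)
      (hne : j ≠ j' ∨ i ≠ i') : Disjoint (D j i) (D j' i') := by
    rw [Finset.disjoint_left]
    intro y hy hy'
    obtain ⟨x, hx, rfl⟩ := Finset.mem_image.1 hy
    obtain ⟨x', hx', hxx'⟩ := Finset.mem_image.1 hy'
    have := hdis j hj i x (Finset.mem_range.1 hx) j' hj' i' x' (Finset.mem_range.1 hx') hxx'.symm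
    tauto
  have hrow (j : ℕ) (hj : j < J) :
      ν.real (⋂ i ∈ Finset.univ, {X | X ∘ h i (n j) ∈ Aᶜ}) = (1 - ν.real A) ^ k := by
    rw [measureReal_def, hν.eq_infinitePi, infinitePi_fairCoin_biInter _ (D j),
      ← hν.eq_infinitePi, ENNReal.toReal_prod]
    · simp only [← measureReal_def]
      rw [Finset.prod_congr rfl fun i _ => hν.real_preimage_comp (hinj i j) hA.compl,
        probReal_compl_eq_one_sub hA]
      simp
    · exact fun i _ X Y hXY hX => fun hY => hX ((hdet j i X Y hXY).2 hY)
    · exact fun i _ i' _ hii' => hDdis j hj j hj i i' (.inr hii')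
  have hset : hitSet A h n J = ⋂ j ∈ Finset.range J,
      (⋂ i ∈ Finset.univ, {X | X ∘ h i (n j) ∈ Aᶜ})ᶜ := by
    ext X
    simp [hitSet]
  have hmeas (j : ℕ) : MeasurableSet (⋂ i ∈ Finset.univ, {X : ℕ → Bool | X ∘ h i (n j) ∈ Aᶜ}) :=
    Finset.measurableSet_biInter _ fun i _ =>
      (show Measurable fun X : ℕ → Bool => X ∘ h i (n j) by
        unfold Function.comp; fun_prop) hA.compl
  rw [hset, measureReal_def, hν.eq_infinitePi,
    infinitePi_fairCoin_biInter _ (fun j => Finset.univ.biUnion (D j)), ← hν.eq_infinitePi,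
    ENNReal.toReal_prod]
  · simp only [← measureReal_def]
    rw [Finset.prod_congr rfl fun j hj => by
      rw [probReal_compl_eq_one_sub (hmeas j), hrow j (Finset.mem_range.1 hj)]]
    simp
  · intro j hj X Y hXY hX hY
    refine hX (Set.mem_iInter₂.2 fun i hi => ?_)
    have := Set.mem_iInter₂.1 hY i hi
    exact fun hX' => this ((hdet j i X Y fun x hx => hXY x
      (Finset.mem_biUnion.2 ⟨i, Finset.mem_univ i, hx⟩)).1 hX')
  · intro j hj j' hj' hne
    simp only [Function.onFun, Finset.disjoint_biUnion_left, Finset.disjoint_biUnion_right]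
    exact fun i _ i' _ => hDdis j (by simpa using hj) j' (by simpa using hj') i' i (.inl hne)

theorem IsUniformMeasure.real_hitSet_openOf_le (hν : IsUniformMeasure ν)
    (hinj : ∀ i j, (h i (n j)).Injective)
    (hdis : ∀ j < J, ∀ i, ∀ x < L, ∀ j' < J, ∀ i', ∀ x' < L,
      h i (n j) x = h i' (n j') x' → j = j' ∧ i = i') :
    ν.real (hitSet (openOf b) h n J) ≤ (1 - (1 - ν.real (openOf b)) ^ k) ^ J +
      J * k * ν.real (openOf b \ {X | b (initSeg X L) = true}) := by
  have := hν.isProbabilityMeasure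
  have hm : MeasurableSet (openOf b \ {X | b (initSeg X L) = true}) :=
    (measurableSet_openOf b).diff (measurableSet_initSeg (fun τ => b τ = true) L)
  refine (measureReal_mono (hitSet_subset (A := {X | b (initSeg X L) = true}) subset_rfl)).trans
    ((measureReal_union_le _ _).trans
      (add_le_add ?_ (hν.real_iUnion_preimage_comp_le hinj hm)))
  rw [hν.real_hitSet_initSeg hinj hdis]
  have hle : ν.real {X | b (initSeg X L) = true} ≤ ν.real (openOf b) :=
    measureReal_mono fun X hX => ⟨L, hX⟩
  have h1 : ν.real (openOf b) ≤ 1 := measureReal_le_one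
  refine pow_le_pow_left₀ (sub_nonneg.2 (pow_le_one₀ (by linarith) (by
    linarith [measureReal_nonneg (μ := ν) (s := {X | b (initSeg X L) = true})]))) ?_ _
  have : (1 - ν.real (openOf b)) ^ k ≤ (1 - ν.real {X | b (initSeg X L) = true}) ^ k :=
    pow_le_pow_left₀ (by linarith) (by linarith) _
  linarith

end HitMeasure

section SchnorrRecurrence

variable {k : ℕ} {b : List Bool → Bool} {h : Fin k → ℕ → ℕ → ℕ} {ν : Measure (ℕ → Bool)}

theorem Rat.cast_toNat_num_div_den (q : ℚ) : ((q.num.toNat : ℝ) / q.den) = max (q : ℝ) 0 := by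
  have hq : (q : ℝ) = (q.num : ℝ) / q.den := by
    exact_mod_cast congrArg (fun r : ℚ => (r : ℝ)) (Rat.num_div_den q).symm
  have hd : (0 : ℝ) < q.den := by exact_mod_cast q.pos
  rcases le_total 0 q.num with h0 | h0
  · have h1 : ((q.num.toNat : ℤ) : ℝ) = q.num := by rw [Int.toNat_of_nonneg h0]
    rw [Int.cast_natCast] at h1
    rw [h1, ← hq, max_eq_left]
    rw [hq]
    have : (0 : ℝ) ≤ q.num := by exact_mod_cast h0
    positivity
  · rw [Int.toNat_of_nonpos h0, max_eq_right]
    · simp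
    · rw [hq]
      have : (q.num : ℝ) ≤ 0 := by exact_mod_cast h0
      exact div_nonpos_of_nonpos_of_nonneg this hd.le

theorem IsUniformMeasure.real_initSeg (hν : IsUniformMeasure ν) (b : List Bool → Bool) (L : ℕ) :
    ν.real {X | b (initSeg X L) = true} = countStrings b L / 2 ^ L := by
  rw [measureReal_def, hν.measure_initSeg]
  simp

theorem IsUniformMeasure.tendsto_real_initSeg (hν : IsUniformMeasure ν)
    (hmono : ∀ σ τ, σ <+: τ → b σ = true → b τ = true) :
    Filter.Tendsto (fun L => ν.real {X | b (initSeg X L) = true}) Filter.atTop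
      (nhds (ν.real (openOf b))) := by
  have := hν.isProbabilityMeasure
  have hO : openOf b = ⋃ L, {X | b (initSeg X L) = true} := by
    ext X; simp [openOf]
  rw [hO]
  refine (ENNReal.tendsto_toReal (measure_ne_top _ _)).comp (tendsto_measure_iUnion_atTop ?_)
  exact fun L M hLM X hX => hmono _ _ (initSeg_prefix X hLM) hX

/-- If the measure of an open set is computable, then its stages can be computed
effectively. -/
theorem exists_computable_stage (hν : IsUniformMeasure ν) (hb : Computable b)
    (hmono : ∀ σ τ, σ <+: τ → b σ = true → b τ = true)
    (hcomp : ComputableReal (1 - ν.real (openOf b))) :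
    ∃ f : ℕ → ℕ, Computable f ∧
      ∀ j, ν.real (openOf b \ {X | b (initSeg X (f j)) = true}) ≤ 2⁻¹ ^ j := by
  have := hν.isProbabilityMeasure
  obtain ⟨q, hq, hqx⟩ := hcomp
  set a : ℕ → ℕ := fun j => (q (j + 2)).num.toNat with ha
  set d : ℕ → ℕ := fun j => (q (j + 2)).den with hd
  have hq2 : Computable fun j => q (j + 2) :=
    hq.comp (Primrec.nat_add.to_comp.comp .id (.const 2))
  have hac : Computable a := Rat.computable_toNat_num.comp hq2
  have hdc : Computable d := Rat.computable_den.comp hq2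
  have key (j L : ℕ) : 2 ^ L * 2 ^ (j + 2) * d j <
        countStrings b L * 2 ^ (j + 2) * d j + a j * 2 ^ L * 2 ^ (j + 2) + 2 * 2 ^ L * d j ↔
      1 - ν.real {X | b (initSeg X L) = true} < max (q (j + 2) : ℝ) 0 + 2 * 2⁻¹ ^ (j + 2) := by
    have hd0 : (0 : ℝ) < d j := by exact_mod_cast (q (j + 2)).pos
    rw [← Rat.cast_toNat_num_div_den, hν.real_initSeg, ← Nat.cast_lt (α := ℝ)]
    change _ ↔ _ < (a j : ℝ) / d j + _
    push_cast
    have hD : (0 : ℝ) < 2 ^ L * 2 ^ (j + 2) * d j := by positivity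
    have heq : (countStrings b L * 2 ^ (j + 2) * d j + a j * 2 ^ L * 2 ^ (j + 2) + 2 * 2 ^ L * d j -
        2 ^ L * 2 ^ (j + 2) * d j : ℝ) = 2 ^ L * 2 ^ (j + 2) * d j *
          (a j / d j + 2 * 2⁻¹ ^ (j + 2) - (1 - countStrings b L / 2 ^ L)) := by
      rw [inv_pow]
      field_simp
      ring
    rw [← sub_pos, heq, mul_pos_iff_of_pos_left hD, sub_pos]
  have hex (j : ℕ) : ∃ L, decide (2 ^ L * 2 ^ (j + 2) * d j <
      countStrings b L * 2 ^ (j + 2) * d j + a j * 2 ^ L * 2 ^ (j + 2) + 2 * 2 ^ L * d j) =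
        true := by
    simp only [decide_eq_true_eq, key]
    have hlt : 1 - ν.real (openOf b) < max (q (j + 2) : ℝ) 0 + 2 * 2⁻¹ ^ (j + 2) := by
      have h1 := (abs_le.1 (hqx (j + 2))).2
      have h2 := le_max_left (q (j + 2) : ℝ) 0
      have h3 : (0 : ℝ) < 2⁻¹ ^ (j + 2) := by positivity
      linarith
    exact (((hν.tendsto_real_initSeg hmono).const_sub 1).eventually_lt_const hlt).exists
  obtain ⟨f, hf, hfs⟩ := Computable.exists_nat_find (Computable.to₂ (f := fun p : ℕ × ℕ =>
    decide (2 ^ p.2 * 2 ^ (p.1 + 2) * d p.1 < countStrings b p.2 * 2 ^ (p.1 + 2) * d p.1 +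
      a p.1 * 2 ^ p.2 * 2 ^ (p.1 + 2) + 2 * 2 ^ p.2 * d p.1)) (by
    have hmul {f g : ℕ × ℕ → ℕ} (hf : Computable f) (hg : Computable g) :
        Computable fun p => f p * g p := Primrec.nat_mul.to_comp.comp hf hg
    have hadd {f g : ℕ × ℕ → ℕ} (hf : Computable f) (hg : Computable g) :
        Computable fun p => f p + g p := Primrec.nat_add.to_comp.comp hf hg
    have hL : Computable fun p : ℕ × ℕ => 2 ^ p.2 := Computable.nat_pow (.const 2) .snd
    have hJ : Computable fun p : ℕ × ℕ => 2 ^ (p.1 + 2) :=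
      Computable.nat_pow (.const 2) (hadd .fst (.const 2))
    have hd' : Computable fun p : ℕ × ℕ => d p.1 := hdc.comp .fst
    have ha' : Computable fun p : ℕ × ℕ => a p.1 := hac.comp .fst
    have hc : Computable fun p : ℕ × ℕ => countStrings b p.2 :=
      Computable.countStrings (hb.comp .snd).to₂ .snd
    exact Computable.nat_lt (hmul (hmul hL hJ) hd')
      (hadd (hadd (hmul (hmul hc hJ) hd') (hmul (hmul ha' hL) hJ))
        (hmul (hmul (.const 2) hL) hd')))) hex
  refine ⟨f, hf, fun j => ?_⟩
  have h1 := (hfs j).1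
  simp only [decide_eq_true_eq, key] at h1
  have h2 := (abs_le.1 (hqx (j + 2))).1
  have h3 : max (q (j + 2) : ℝ) 0 ≤ 1 - ν.real (openOf b) + 2⁻¹ ^ (j + 2) := by
    refine max_le (by linarith) ?_
    have h4 : ν.real (openOf b) ≤ 1 := measureReal_le_one
    have h5 : (0 : ℝ) < 2⁻¹ ^ (j + 2) := by positivity
    linarith
  rw [measureReal_sdiff
    (show {X | b (initSeg X (f j)) = true} ⊆ openOf b from fun X hX => ⟨f j, hX⟩)
    (measurableSet_initSeg (fun τ => b τ = true) (f j))]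
  have h6 : (2⁻¹ : ℝ) ^ (j + 2) = 2⁻¹ ^ j / 4 := by ring
  have h7 : (0 : ℝ) < 2⁻¹ ^ j := by positivity
  linarith

theorem SchnorrRandom.exists_forall_comp_notMem_openOf (hν : IsUniformMeasure ν)
    (hb : Computable b) (hmono : ∀ σ τ, σ <+: τ → b σ = true → b τ = true)
    (hcomp : ComputableReal (1 - ν.real (openOf b))) (hlt : ν.real (openOf b) < 1)
    (hh : ∀ i, Computable fun p : ℕ × ℕ => h i p.1 p.2) (hinj : ∀ i n, (h i n).Injective)
    {N : ℕ → ℕ} (hN : Computable N) (hNpos : ∀ L, 1 ≤ N L)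
    (hdis : ∀ L j j', 1 ≤ j → 1 ≤ j' → ∀ i, ∀ x < L, ∀ i', ∀ x' < L,
      h i (j * N L) x = h i' (j' * N L) x' → j = j' ∧ i = i')
    {X : ℕ → Bool} (hX : SchnorrRandom ν X) :
    ∃ n, 1 ≤ n ∧ ∀ i, X ∘ h i n ∉ openOf b := by
  have := hν.isProbabilityMeasure
  by_contra! hc
  obtain ⟨f, hf, hfm⟩ := exists_computable_stage hν hb hmono hcomp
  have hO0 : 0 ≤ ν.real (openOf b) := measureReal_nonneg
  have hp0 : 0 < (1 - ν.real (openOf b)) ^ k := pow_pos (by linarith) _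
  have hp1 : (1 - ν.real (openOf b)) ^ k ≤ 1 := pow_le_one₀ (by linarith) (by linarith)
  obtain ⟨c, hc2⟩ := exists_pow_lt_of_lt_one (show (0 : ℝ) < 2⁻¹ by norm_num)
    (show 1 - (1 - ν.real (openOf b)) ^ k < 1 by linarith)
  set J : ℕ → ℕ := fun m => c * (m + 1) with hJ
  set n : ℕ → ℕ → ℕ := fun m j => (j + 1) * N (f (m + 1 + k * J m)) with hn
  have hmul {α : Type} [Primcodable α] {f g : α → ℕ} (hf : Computable f) (hg : Computable g) :
      Computable fun p => f p * g p := Primrec.nat_mul.to_comp.comp hf hg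
  have hadd {α : Type} [Primcodable α] {f g : α → ℕ} (hf : Computable f) (hg : Computable g) :
      Computable fun p => f p + g p := Primrec.nat_add.to_comp.comp hf hg
  have hJc : Computable J := hmul (.const c) Computable.succ
  have hnc : Computable₂ n := Computable.to₂ (f := fun p : ℕ × ℕ =>
    (p.2 + 1) * N (f (p.1 + 1 + k * J p.1))) (hmul (Computable.succ.comp .snd)
      (hN.comp (hf.comp (hadd (Computable.succ.comp .fst)
        (hmul (.const k) (hJc.comp .fst))))))
  have hBc : Computable₂ fun (m : ℕ) (τ : List Bool) => hitAll b h (n m) (J m) τ :=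
    Computable.hitAll (n := fun p : ℕ × List Bool => n p.1) hb hh
      (hnc.comp (Computable.fst.comp .fst) .snd).to₂ (hJc.comp .fst) .snd
  have hsmall (m s : ℕ) : (J m : ℝ) * k * 2⁻¹ ^ (s + k * J m) ≤ 2⁻¹ ^ s := by
    have h1 : ((k * J m : ℕ) : ℝ) ≤ 2 ^ (k * J m) := by
      exact_mod_cast Nat.lt_two_pow_self.le
    rw [pow_add, inv_pow 2 (k * J m)]
    have h2 : (0 : ℝ) < 2 ^ (k * J m) := by positivity
    have h3 : (0 : ℝ) < 2⁻¹ ^ s := by positivity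
    calc (J m : ℝ) * k * (2⁻¹ ^ s * (2 ^ (k * J m))⁻¹)
        = 2⁻¹ ^ s * (((k * J m : ℕ) : ℝ) * (2 ^ (k * J m))⁻¹) := by push_cast; ring
      _ ≤ 2⁻¹ ^ s * 1 := by
          gcongr
          rw [← div_eq_mul_inv]
          exact div_le_one_of_le₀ h1 h2.le
      _ = _ := mul_one _
  suffices hS : SchnorrTest ν fun m => {τ | hitAll b h (n m) (J m) τ = true} by
    obtain ⟨m, hm⟩ := hX _ hS
    refine hm ?_
    rw [openCl_hitAll]
    exact fun j _ => hc _ (Nat.mul_pos j.succ_pos (hNpos _))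
  refine ⟨?_, ?_, ?_⟩
  · refine ⟨fun m s => (Encodable.decode (α := List Bool) s).bind fun τ =>
      bif hitAll b h (n m) (J m) τ then some τ else none, ?_, fun m => ?_⟩
    · refine Computable.to₂ (f := fun p : ℕ × ℕ => (Encodable.decode (α := List Bool) p.2).bind
        fun τ => bif hitAll b h (n p.1) (J p.1) τ then some τ else none) ?_
      exact Computable.option_bind (Computable.decode.comp .snd) (Computable.to₂
        (f := fun p : (ℕ × ℕ) × List Bool =>
          bif hitAll b h (n p.1.1) (J p.1.1) p.2 then some p.2 else none)
        (Computable.cond (hBc.comp (Computable.fst.comp .fst) .snd)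
          (Computable.option_some.comp .snd) (.const none)))
    · ext τ
      simp only [Set.mem_ofPred_eq, Option.bind_eq_some_iff, Bool.cond_eq_ite]
      constructor
      · exact fun hτ => ⟨Encodable.encode τ, τ, Encodable.encodek τ, by simp [hτ]⟩
      · rintro ⟨s, τ', -, hτ'⟩
        split_ifs at hτ' with h1
        · rwa [← Option.some.inj hτ']
  · intro m
    rw [openCl_hitAll, ← ENNReal.toReal_le_toReal (measure_ne_top _ _) (by simp), ← measureReal_def]
    refine (hν.real_hitSet_openOf_le (L := f (m + 1 + k * J m)) (fun i j => hinj i _) ?_).trans ?_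
    · intro j _ i x hx j' _ i' x' hx' heq
      have := hdis _ (j + 1) (j' + 1) (by omega) (by omega) i x hx i' x' hx' heq
      exact ⟨by omega, this.2⟩
    · have h1 : (1 - (1 - ν.real (openOf b)) ^ k) ^ J m ≤ 2⁻¹ ^ (m + 1) := by
        rw [hJ, pow_mul]
        exact pow_le_pow_left₀ (pow_nonneg (by linarith) _) hc2.le _
      have h2 := (mul_le_mul_of_nonneg_left (hfm (m + 1 + k * J m))
        (show (0 : ℝ) ≤ J m * k by positivity)).trans (hsmall m (m + 1))
      have h3 : (2⁻¹ : ℝ) ^ (m + 1) = 2⁻¹ ^ m / 2 := by ring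
      simp only [ENNReal.toReal_pow, ENNReal.toReal_inv, ENNReal.toReal_ofNat]
      linarith
  · set L : ℕ → ℕ → ℕ := fun m s => f (s + k * J m) with hL
    set L' : ℕ → ℕ → ℕ := fun m s => L m s + ∑ j ∈ Finset.range (J m), ∑ i,
      ∑ x ∈ Finset.range (L m s), (h i (n m j) x + 1) with hL'
    have hLc : Computable fun p : ℕ × ℕ => L p.1 p.2 :=
      hf.comp (hadd .snd (hmul (.const k) (hJc.comp .fst)))
    have hL'c : Computable fun p : ℕ × ℕ => L' p.1 p.2 := by
      refine hadd hLc (Computable.sum_range (hJc.comp .fst) (Computable.to₂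
        (f := fun p : (ℕ × ℕ) × ℕ => ∑ i, ∑ x ∈ Finset.range (L p.1.1 p.1.2),
          (h i (n p.1.1 p.2) x + 1)) (Computable.sum_fin fun i => Computable.sum_range
            (hLc.comp .fst) (Computable.to₂ (f := fun q : ((ℕ × ℕ) × ℕ) × ℕ =>
              h i (n q.1.1.1 q.1.2) q.2 + 1) (Computable.succ.comp ((hh i).comp
                (Computable.pair (hnc.comp (Computable.fst.comp (Computable.fst.comp .fst))
                  (Computable.snd.comp .fst)) .snd)))))))
    refine ⟨fun m s => (countStrings (hitAll b h (n m) (J m)) (L' m s) : ℚ) /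
      ((2 ^ L' m s : ℕ) : ℚ), Computable.to₂ (Computable.rat_div (α := ℕ × ℕ)
        (f := fun p => countStrings (hitAll b h (n p.1) (J p.1)) (L' p.1 p.2))
        (g := fun p => 2 ^ L' p.1 p.2)
        (Computable.countStrings (hBc.comp (Computable.fst.comp .fst) .snd).to₂ hL'c)
        (Computable.nat_pow (.const 2) hL'c) fun _ => by positivity), fun m s => ?_⟩
    have h1 := hν.abs_real_hitSet_sub_le (b := b) (h := h) (n := n m) (J := J m) (L := L m s)
      (L' := L' m s) (fun i j => hinj i _) (Nat.le_add_right _ _) fun j hj i x hx => by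
        have e1 := Finset.single_le_sum (f := fun x => h i (n m j) x + 1)
          (fun _ _ => Nat.zero_le _) (Finset.mem_range.2 hx)
        have e2 := Finset.single_le_sum (f := fun i => ∑ x ∈ Finset.range (L m s),
          (h i (n m j) x + 1)) (fun _ _ => Nat.zero_le _) (Finset.mem_univ i)
        have e3 := Finset.single_le_sum (f := fun j => ∑ i, ∑ x ∈ Finset.range (L m s),
          (h i (n m j) x + 1)) (fun _ _ => Nat.zero_le _) (Finset.mem_range.2 hj)
        have e4 : h i (n m j) x + 1 ≤ L' m s := (e1.trans (e2.trans e3)).trans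
          (Nat.le_add_left _ _)
        omega
    rw [hν.real_initSeg] at h1
    rw [openCl_hitAll, ← measureReal_def]
    push_cast
    exact h1.trans ((mul_le_mul_of_nonneg_left (hfm (s + k * J m)) (by positivity)).trans
      (hsmall m s))

end SchnorrRecurrence

section Arrays

variable {k : ℕ}

/-- The point of `ℕ^k` whose coordinates are the base `n` digits of `c`. -/
def digitPoint (k n c : ℕ) : Fin k → ℕ := fun j => c / n ^ (j : ℕ) % n

/-- The string `τ` witnesses that `X ∘ e` agrees with the array coded by `p`. -/
def arrayCheck (e : (Fin k → ℕ) → ℕ) (τ : List Bool) (p : ℕ × List Bool) : Bool :=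
  decide (p.2.length = p.1 ^ k) && decide (∀ c < p.1 ^ k,
    (decide (e (digitPoint k p.1 c) < τ.length) &&
      decide (τ.getD (e (digitPoint k p.1 c)) false = p.2.getD c false)) = true)

/-- The string `τ` witnesses that `X ∘ e` agrees with an array enumerated by `f` before
stage `τ.length`. -/
def arrayHit (e : (Fin k → ℕ) → ℕ) (f : ℕ → Option (ℕ × List Bool)) (τ : List Bool) : Bool :=
  decide (∃ t < τ.length, (Option.casesOn (f t) false (arrayCheck e τ) : Bool) = true)

theorem Computable.fin_lambda {α β : Type*} [Primcodable α] [Primcodable β] {f : Fin k → α → β}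
    (hf : ∀ i, Computable (f i)) : Computable fun a i => f i a :=
  (Primrec.vector_get'.to_comp.comp (Computable.vector_ofFn hf)).of_eq fun a => by
    funext i; simp

theorem Computable.digitPoint {α : Type*} [Primcodable α] {n c : α → ℕ} (hn : Computable n)
    (hc : Computable c) : Computable fun a => digitPoint k (n a) (c a) :=
  Computable.fin_lambda fun _ => Primrec.nat_mod.to_comp.comp
    (Primrec.nat_div.to_comp.comp hc (Computable.nat_pow hn (.const _))) hn

theorem Computable.arrayHit {e : (Fin k → ℕ) → ℕ} {f : ℕ → Option (ℕ × List Bool)}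
    (he : Computable e) (hf : Computable f) : Computable (arrayHit e f) := by
  refine Computable.exists_lt Computable.list_length (Computable.to₂
    (f := fun p : List Bool × ℕ => (Option.casesOn (f p.2) false (arrayCheck e p.1) : Bool)) ?_)
  refine Computable.option_casesOn (hf.comp .snd) (.const false) (Computable.to₂
    (f := fun q : (List Bool × ℕ) × (ℕ × List Bool) => arrayCheck e q.1.1 q.2) ?_)
  have hn : Computable fun q : (List Bool × ℕ) × (ℕ × List Bool) => q.2.1 :=
    Computable.fst.comp .snd
  have hl : Computable fun q : (List Bool × ℕ) × (ℕ × List Bool) => q.2.2 :=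
    Computable.snd.comp .snd
  have hτ : Computable fun q : (List Bool × ℕ) × (ℕ × List Bool) => q.1.1 :=
    Computable.fst.comp .fst
  have hnk := Computable.nat_pow hn (.const k)
  refine Primrec.and.to_comp.comp
    (Primrec.eq.decide.to_comp.comp (Computable.list_length.comp hl) hnk)
    (Computable.forall_lt hnk (Computable.to₂
      (f := fun r : ((List Bool × ℕ) × (ℕ × List Bool)) × ℕ =>
        decide (e (_root_.digitPoint k r.1.2.1 r.2) < r.1.1.1.length) &&
          decide (r.1.1.1.getD (e (_root_.digitPoint k r.1.2.1 r.2)) false =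
            r.1.2.2.getD r.2 false)) ?_))
  have hd : Computable fun r : ((List Bool × ℕ) × (ℕ × List Bool)) × ℕ =>
      e (_root_.digitPoint k r.1.2.1 r.2) :=
    he.comp (Computable.digitPoint (hn.comp .fst) .snd)
  exact Primrec.and.to_comp.comp
    (Computable.nat_lt hd (Computable.list_length.comp (hτ.comp .fst)))
    (Primrec.eq.decide.to_comp.comp ((Primrec.list_getD false).to_comp.comp (hτ.comp .fst) hd)
      ((Primrec.list_getD false).to_comp.comp (hl.comp .fst) .snd))

theorem arrayCheck_iff {e : (Fin k → ℕ) → ℕ} {τ : List Bool} {p : ℕ × List Bool} :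
    arrayCheck e τ p = true ↔ p.2.length = p.1 ^ k ∧ ∀ c < p.1 ^ k,
      e (digitPoint k p.1 c) < τ.length ∧
        τ.getD (e (digitPoint k p.1 c)) false = p.2.getD c false := by
  simp [arrayCheck]

theorem arrayHit_iff {e : (Fin k → ℕ) → ℕ} {f : ℕ → Option (ℕ × List Bool)} {τ : List Bool} :
    arrayHit e f τ = true ↔ ∃ t < τ.length, ∃ p, f t = some p ∧ arrayCheck e τ p = true := by
  simp only [arrayHit, decide_eq_true_eq]
  refine exists_congr fun t => and_congr_right fun _ => ?_
  cases f t <;> simp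

theorem arrayHit_mono {e : (Fin k → ℕ) → ℕ} {f : ℕ → Option (ℕ × List Bool)} {σ τ : List Bool}
    (hστ : σ <+: τ) (hσ : arrayHit e f σ = true) : arrayHit e f τ = true := by
  obtain ⟨t, ht, p, hp, hc⟩ := arrayHit_iff.1 hσ
  rw [arrayCheck_iff] at hc
  refine arrayHit_iff.2 ⟨t, ht.trans_le hστ.length_le, p, hp, arrayCheck_iff.2
    ⟨hc.1, fun c hcn => ⟨(hc.2 c hcn).1.trans_le hστ.length_le, ?_⟩⟩⟩
  obtain ⟨ρ, rfl⟩ := hστ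
  rw [← (hc.2 c hcn).2, List.getD_append _ _ _ _ (hc.2 c hcn).1]

theorem arrayAgrees_iff {n : ℕ} {l : List Bool} {Z : (Fin k → ℕ) → Bool} :
    ArrayAgrees n l Z ↔
      l.length = n ^ k ∧ ∀ c < n ^ k, Z (digitPoint k n c) = l.getD c false := by
  refine and_congr_right fun _ => ⟨fun H c hc => ?_, fun H u => ?_⟩
  · have := H (finFunctionFinEquiv.symm ⟨c, hc⟩)
    rw [Equiv.apply_symm_apply] at this
    exact this.symm
  · have := H (finFunctionFinEquiv u) (finFunctionFinEquiv u).2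
    rw [← this]
    have hu := finFunctionFinEquiv.symm_apply_apply u
    congr 1
    funext j
    exact congrArg Fin.val (congrFun hu j)

theorem mem_openOf_arrayHit {e : (Fin k → ℕ) → ℕ} {f : ℕ → Option (ℕ × List Bool)}
    {X : ℕ → Bool} :
    X ∈ openOf (arrayHit e f) ↔ X ∘ e ∈ openClK {p | ∃ t, f t = some p} := by
  constructor
  · rintro ⟨L, hL⟩
    obtain ⟨t, -, p, hp, hc⟩ := arrayHit_iff.1 hL
    rw [arrayCheck_iff, length_initSeg] at hc
    refine ⟨p, ⟨t, hp⟩, arrayAgrees_iff.2 ⟨hc.1, fun c hcn => ?_⟩⟩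
    rw [← (hc.2 c hcn).2, getD_initSeg _ (hc.2 c hcn).1, Function.comp]
  · rintro ⟨p, ⟨t, hp⟩, hc⟩
    rw [arrayAgrees_iff] at hc
    have hlt (c : ℕ) (hcn : c < p.1 ^ k) : e (digitPoint k p.1 c) <
        t + 1 + ∑ c ∈ Finset.range (p.1 ^ k), (e (digitPoint k p.1 c) + 1) := by
      have := Finset.single_le_sum (f := fun c => e (digitPoint k p.1 c) + 1)
        (fun _ _ => Nat.zero_le _) (Finset.mem_range.2 hcn)
      omega
    refine ⟨t + 1 + ∑ c ∈ Finset.range (p.1 ^ k), (e (digitPoint k p.1 c) + 1),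
      arrayHit_iff.2 ⟨t, by rw [length_initSeg]; omega, p, hp, arrayCheck_iff.2
        ⟨hc.1, fun c hcn => ⟨by rw [length_initSeg]; exact hlt c hcn, ?_⟩⟩⟩⟩
    rw [getD_initSeg _ (hlt c hcn), ← hc.2 c hcn, Function.comp]

end Arrays

section Translation

variable {k : ℕ}

/-- Translation of `u` by `n` in the direction `i`. -/
def translateK (i : Fin k) (n : ℕ) (u : Fin k → ℕ) : Fin k → ℕ :=
  fun j => if j = i then u j + n else u j

theorem shiftK_iterate (i : Fin k) (n : ℕ) (Z : (Fin k → ℕ) → Bool) :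
    (shiftK i)^[n] Z = Z ∘ translateK i n := by
  induction n with
  | zero =>
    funext u
    exact congrArg Z (funext fun j => by simp [translateK])
  | succ n ih =>
    rw [Function.iterate_succ_apply', ih]
    funext u
    simp only [shiftK, Function.comp]
    congr 1
    funext j
    by_cases hj : j = i
    · simp only [translateK, hj, if_true]; omega
    · simp only [translateK, hj, if_false]

theorem translateK_injective (i : Fin k) (n : ℕ) : (translateK i n).Injective := by
  intro u v huv
  funext j
  have := congrFun huv j
  simp only [translateK] at this
  split_ifs at this <;> omega

theorem translateK_eq_translateK {N a a' : ℕ} {i i' : Fin k} {u u' : Fin k → ℕ} (ha : 1 ≤ a)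
    (hu : ∀ j, u j < N) (hu' : ∀ j, u' j < N)
    (h : translateK i (a * N) u = translateK i' (a' * N) u') : a = a' ∧ i = i' := by
  have hi : i = i' := by
    by_contra hne
    have h1 := congrFun h i
    simp only [translateK, if_true, hne, if_false] at h1
    have := hu' i
    have := Nat.le_mul_of_pos_left N ha
    omega
  subst hi
  refine ⟨?_, rfl⟩
  have h1 := congrFun h i
  simp only [translateK, if_true] at h1
  have h2 := hu i
  have h3 := hu' i
  have hN : 0 < N := by omega
  have h4 := congrArg (· / N) h1
  simpa only [Nat.add_mul_div_right _ _ hN, Nat.div_eq_of_lt h2, Nat.div_eq_of_lt h3,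
    zero_add] using h4

end Translation

/-- Every Schnorr random point of `X_k = {0,1}^(ℕ^k)` (randomness being transported from
Cantor space along a computable bijection `ℕ^k ≃ ℕ`) is multiply recurrent in every
Π⁰₁ class `P ⊆ X_k` with `μ P > 0` and `μ P` a computable real. -/
theorem schnorrRandomK_multiplyRecurrent_pi01 (k : ℕ) (hk : 1 ≤ k)
    (μ : Measure ((Fin k → ℕ) → Bool)) (hμ : IsUniformMeasureK μ)
    (ν : Measure (ℕ → Bool)) (hν : IsUniformMeasure ν)
    (P : Set ((Fin k → ℕ) → Bool)) (hP : Pi01ClassK P)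
    (hPpos : 0 < μ P) (hPcomp : ComputableReal (μ P).toReal)
    (Z : (Fin k → ℕ) → Bool)
    (e : (Fin k → ℕ) ≃ ℕ) (he : Computable (fun u => e u))
    (he' : Computable (fun m => e.symm m))
    (hZ : SchnorrRandom ν (fun m => Z (e.symm m))) :
    MultiplyRecurrentK P Z := by
  obtain ⟨W, ⟨f, hf, rfl⟩, rfl⟩ := hP
  have := hν.isProbabilityMeasure
  set O := openOf (arrayHit e f) with hO
  have hW : openClK {p | ∃ t, f t = some p} = {Z : (Fin k → ℕ) → Bool | Z ∘ e.symm ∈ O} := by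
    ext Z
    rw [Set.mem_ofPred_eq, hO, mem_openOf_arrayHit, Function.comp_assoc, e.symm_comp_self,
      Function.comp_id]
  have hOm : MeasurableSet O := measurableSet_openOf _
  have hμO : μ (openClK {p | ∃ t, f t = some p})ᶜ = ν Oᶜ := by
    rw [hW, hμ.eq_infinitePi, hν.eq_infinitePi]
    exact infinitePi_fairCoin_preimage_comp e.symm.injective hOm.compl
  rw [hμO, ← measureReal_def, probReal_compl_eq_one_sub hOm] at hPcomp
  have hlt : ν.real O < 1 := by
    rw [hμO] at hPpos
    have := ENNReal.toReal_pos hPpos.ne' (measure_ne_top ν _)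
    rw [← measureReal_def, probReal_compl_eq_one_sub hOm] at this
    linarith
  have happ {i : Fin k} : Computable fun x => e.symm x i :=
    Computable.fin_app.comp he' (.const i)
  obtain ⟨n, hn, hr⟩ := hZ.exists_forall_comp_notMem_openOf hν (b := arrayHit e f)
    (h := fun i n x => e (translateK i n (e.symm x)))
    (N := fun L => 1 + ∑ x ∈ Finset.range L, ∑ i, e.symm x i)
    (Computable.arrayHit he hf) (fun _ _ => arrayHit_mono) hPcomp hlt
    (fun i => he.comp (Computable.fin_lambda fun j => by
      by_cases hj : j = i
      · simpa only [translateK, hj, if_true] using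
          Primrec.nat_add.to_comp.comp (happ.comp .snd) .fst
      · simpa only [translateK, hj, if_false] using happ.comp .snd))
    (fun i n => e.injective.comp ((translateK_injective i n).comp e.symm.injective))
    (Primrec.nat_add.to_comp.comp (.const 1) (Computable.sum_range .id
      (Computable.sum_fin fun i => (happ.comp .snd : Computable fun p : ℕ × ℕ => _))))
    (fun L => Nat.le_add_right _ _)
    (fun L j j' hj _ i x hx i' x' hx' heq => by
      have hlt (x : ℕ) (hx : x < L) (a : Fin k) :
          e.symm x a < 1 + ∑ x ∈ Finset.range L, ∑ i, e.symm x i := by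
        have e1 := Finset.single_le_sum (f := fun i => e.symm x i) (fun _ _ => Nat.zero_le _)
          (Finset.mem_univ a)
        have e2 := Finset.single_le_sum (f := fun x => ∑ i, e.symm x i)
          (fun _ _ => Nat.zero_le _) (Finset.mem_range.2 hx)
        exact Nat.lt_one_add_iff.2 (e1.trans e2)
      exact translateK_eq_translateK hj (hlt x hx) (hlt x' hx') (e.injective heq))
  refine ⟨n, hn, Set.mem_iInter.2 fun i hi => hr i ?_⟩
  rw [mem_openOf_arrayHit]
  have hcomp : ((fun m => Z (e.symm m)) ∘ fun x => e (translateK i n (e.symm x))) ∘ e =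
      (shiftK i)^[n] Z := by
    rw [shiftK_iterate]
    funext u
    simp [Function.comp]
  rw [hcomp]
  exact hi
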